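/- For every integer e ≥ 1, B_e < A_e, where A_e^4 = inf{ −(2/3)^e ∏_{j=1}^e x_j + 2 ∏_{j=1}^e Ω(1/x_j, 0) : x_1,…,x_e > 0 } and B_e^4 = inf{ −(2^{e+1}/3^e) ∏_{j=1}^e x_j + 2 ∏_{j=1}^e Ω(1/x_j, 0) + ∏_{j=1}^e Ω(1/x_j, 1 + 2y_j/x_j) : x_1,…,x_e > 0, y_1,…,y_e ∈ ℝ } (with A_e and B_e taken to be the positive fourth roots of these infima, which are positive). -/

import Mathlib

/-- `Omega x y = ∑_{n ∈ ℤ} max(0, 1 - |x n - y|)^2`. -/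
noncomputable def Omega (x y : ℝ) : ℝ := ∑' n : ℤ, max 0 (1 - |x * (n : ℝ) - y|) ^ 2

/-- `Aquart e` is the infimum of the limiting values of `(‖f‖₄/‖f‖₂)⁴` over size-stable
families of `e`-variable non-quadratic multiplicative character polynomials. -/
noncomputable def Aquart (e : ℕ) : ℝ :=
  sInf {r : ℝ | ∃ x : Fin e → ℝ, (∀ j, 0 < x j) ∧
    r = -(2 / 3 : ℝ) ^ e * ∏ j, x j + 2 * ∏ j, Omega (1 / x j) 0}

/-- `Bquart e` is the infimum of the limiting values of `(‖f‖₄/‖f‖₂)⁴` over size- and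
translation-stable families of `e`-variable quadratic multiplicative character polynomials. -/
noncomputable def Bquart (e : ℕ) : ℝ :=
  sInf {r : ℝ | ∃ x y : Fin e → ℝ, (∀ j, 0 < x j) ∧
    r = -((2 : ℝ) ^ (e + 1) / 3 ^ e) * ∏ j, x j + 2 * ∏ j, Omega (1 / x j) 0 +
      ∏ j, Omega (1 / x j) (1 + 2 * y j / x j)}

lemma summable_Omega {x : ℝ} (hx : 0 < x) (y : ℝ) :
    Summable fun n : ℤ => max 0 (1 - |x * (n : ℝ) - y|) ^ 2 := by
  refine summable_of_ne_finset_zero (s := Finset.Icc ⌊(y - 1) / x⌋ ⌈(y + 1) / x⌉) fun n hn => ?_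
  have h : 1 ≤ |x * (n : ℝ) - y| := by
    by_contra! h
    obtain ⟨h₁, h₂⟩ := abs_lt.1 h
    refine hn (Finset.mem_Icc.2 ⟨?_, ?_⟩)
    · have : ((⌊(y - 1) / x⌋ : ℤ) : ℝ) ≤ n :=
        (Int.floor_le _).trans ((div_le_iff₀ hx).2 (by linarith))
      exact_mod_cast this
    · have : (n : ℝ) ≤ (⌈(y + 1) / x⌉ : ℤ) :=
        ((le_div_iff₀ hx).2 (by linarith)).trans (Int.le_ceil _)
      exact_mod_cast this
  rw [max_eq_left (by linarith)]
  norm_num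

lemma sum_le_Omega {x : ℝ} (hx : 0 < x) (y : ℝ) (s : Finset ℤ) :
    ∑ n ∈ s, max 0 (1 - |x * (n : ℝ) - y|) ^ 2 ≤ Omega x y :=
  (summable_Omega hx y).sum_le_tsum s fun _ _ => sq_nonneg _

lemma Omega_nonneg (x y : ℝ) : 0 ≤ Omega x y :=
  tsum_nonneg fun _ => sq_nonneg _

lemma one_le_Omega_zero {x : ℝ} (hx : 0 < x) : 1 ≤ Omega (1 / x) 0 := by
  simpa using sum_le_Omega (one_div_pos.2 hx) 0 {0}

lemma Omega_zero_eq_one {x : ℝ} (hx : 0 < x) (hx1 : x ≤ 1) : Omega (1 / x) 0 = 1 := by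
  rw [Omega, tsum_eq_single 0]
  · simp
  · intro n hn
    have h1 : (1 : ℝ) ≤ |(n : ℝ)| := by exact_mod_cast Int.one_le_abs hn
    have h2 : 1 ≤ 1 / x := (one_le_div hx).2 hx1
    have h : 1 ≤ |1 / x * (n : ℝ) - 0| := by
      rw [sub_zero, abs_mul, abs_of_pos (by positivity)]
      nlinarith
    rw [max_eq_left (by linarith)]
    norm_num

lemma sum_Icc_sub_abs_sq (x : ℝ) (N : ℕ) :
    ∑ n ∈ Finset.Icc (-(N : ℤ)) N, (x - |(n : ℝ)|) ^ 2 =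
      x ^ 2 * (1 + 2 * N) - 2 * x * N * (N + 1) + N * (N + 1) * (2 * N + 1) / 3 := by
  induction N with
  | zero => simp
  | succ N ih =>
    have h : Finset.Icc (-((N + 1 : ℕ) : ℤ)) ((N + 1 : ℕ) : ℤ) =
        insert ((N : ℤ) + 1) (insert (-((N : ℤ) + 1)) (Finset.Icc (-(N : ℤ)) N)) := by
      ext n
      simp only [Finset.mem_Icc, Finset.mem_insert]
      omega
    rw [h, Finset.sum_insert (by simp only [Finset.mem_Icc, Finset.mem_insert]; omega),
      Finset.sum_insert (by simp only [Finset.mem_Icc]; omega), ih]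
    have h0 : (0 : ℝ) ≤ (N : ℝ) + 1 := by positivity
    push_cast
    rw [abs_neg, abs_of_nonneg h0]
    ring

/-- The trapezoidal rule overestimates the integral of `max 0 (1 - |u|) ^ 2`. -/
lemma two_thirds_mul_le_Omega_zero {x : ℝ} (hx : 0 < x) : 2 / 3 * x ≤ Omega (1 / x) 0 := by
  set N := ⌊x⌋₊
  have hN : (N : ℝ) ≤ x := Nat.floor_le hx.le
  have hN' : x < N + 1 := Nat.lt_floor_add_one x
  refine le_trans ?_ (sum_le_Omega (one_div_pos.2 hx) 0 (Finset.Icc (-(N : ℤ)) N))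
  have h : ∑ n ∈ Finset.Icc (-(N : ℤ)) N, max 0 (1 - |1 / x * (n : ℝ) - 0|) ^ 2 =
      (∑ n ∈ Finset.Icc (-(N : ℤ)) N, (x - |(n : ℝ)|) ^ 2) / x ^ 2 := by
    rw [Finset.sum_div]
    refine Finset.sum_congr rfl fun n hn => ?_
    have hn' : |(n : ℝ)| ≤ N := by
      have := abs_le.2 (Finset.mem_Icc.1 hn)
      exact_mod_cast this
    have h1 : 1 - |1 / x * (n : ℝ) - 0| = (x - |(n : ℝ)|) / x := by
      rw [sub_zero, abs_mul, abs_of_pos (one_div_pos.2 hx)]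
      field_simp
    rw [h1, max_eq_right (div_nonneg (by linarith) hx.le), div_pow]
  rw [h, sum_Icc_sub_abs_sq, le_div_iff₀ (by positivity)]
  obtain ⟨θ, hθ⟩ : ∃ θ, θ = x - N := ⟨_, rfl⟩
  have h0 : 0 ≤ θ := by linarith
  have h1 : 0 ≤ 1 - θ := by linarith
  have hxθ : x = N + θ := by linarith
  have hNn : (0 : ℝ) ≤ N := N.cast_nonneg
  rw [hxθ]
  nlinarith [mul_nonneg (sq_nonneg θ) h1, sq_nonneg θ]

lemma quarter_le_Omega {x : ℝ} (hx : 1 ≤ x) (y : ℝ) : 1 / 4 ≤ Omega (1 / x) y := by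
  have hx0 : 0 < x := by linarith
  have h := sum_le_Omega (one_div_pos.2 hx0) y {round (x * y)}
  rw [Finset.sum_singleton] at h
  have h1 : |1 / x * (round (x * y) : ℝ) - y| ≤ 1 / 2 := by
    have h2 : 1 / x * (round (x * y) : ℝ) - y = -((x * y - round (x * y)) / x) := by
      field_simp
      ring
    rw [h2, abs_neg, abs_div, abs_of_pos hx0, div_le_iff₀ hx0]
    linarith [abs_sub_round (x * y)]
  have h3 := (show (1 : ℝ) / 2 ≤ 1 - |1 / x * (round (x * y) : ℝ) - y| by linarith).trans
    (le_max_right 0 _)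
  nlinarith

/-- The midpoint rule underestimates the integral of `max 0 (1 - |u|) ^ 2`, quantitatively
for mesh `1 / x` with `1 ≤ x ≤ 3`. -/
lemma Omega_midpoint_le {x : ℝ} (hx1 : 1 ≤ x) (hx3 : x ≤ 3) :
    Omega (1 / x) (1 + 2 * (1 / 4 - x / 2) / x) ≤ 107 / 108 * (2 / 3 * x) := by
  have hx0 : 0 < x := by linarith
  have hterm (n : ℤ) : 1 - |1 / x * (n : ℝ) - (1 + 2 * (1 / 4 - x / 2) / x)| =
      (x - |(n : ℝ) - 1 / 2|) / x := by
    have : 1 / x * (n : ℝ) - (1 + 2 * (1 / 4 - x / 2) / x) = ((n : ℝ) - 1 / 2) / x := by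
      field_simp
      ring
    rw [this, abs_div, abs_of_pos hx0, sub_div, div_self hx0.ne']
  have hmax (a : ℝ) : max 0 (a / x) ^ 2 = max 0 a ^ 2 / x ^ 2 := by
    rw [← div_pow, ← max_div_div_right hx0.le, zero_div]
  rw [Omega, tsum_eq_sum (s := Finset.Icc (-2) 3)]
  · simp only [hterm, hmax]
    rw [← Finset.sum_div, div_le_iff₀ (by positivity)]
    have hs : Finset.Icc (-2 : ℤ) 3 = {-2, -1, 0, 1, 2, 3} := by decide
    have habs : |(-2 : ℝ) - 1 / 2| = 5 / 2 ∧ |(-1 : ℝ) - 1 / 2| = 3 / 2 ∧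
        |(0 : ℝ) - 1 / 2| = 1 / 2 ∧ |(1 : ℝ) - 1 / 2| = 1 / 2 ∧
        |(2 : ℝ) - 1 / 2| = 3 / 2 ∧ |(3 : ℝ) - 1 / 2| = 5 / 2 := by
      refine ⟨?_, ?_, ?_, ?_, ?_, ?_⟩ <;> norm_num [abs_div]
    obtain ⟨a1, a2, a3, a4, a5, a6⟩ := habs
    have hsum : ∑ n ∈ Finset.Icc (-2 : ℤ) 3, max 0 (x - |(n : ℝ) - 1 / 2|) ^ 2 =
        2 * (max 0 (x - 1 / 2) ^ 2 + max 0 (x - 3 / 2) ^ 2 + max 0 (x - 5 / 2) ^ 2) := by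
      rw [hs]
      repeat rw [Finset.sum_insert (by decide)]
      rw [Finset.sum_singleton]
      push_cast
      rw [a1, a2, a3, a4, a5, a6]
      ring
    rw [hsum, max_eq_right (show 0 ≤ x - 1 / 2 by linarith)]
    have hcube : x ^ 3 ≤ 27 := by
      calc x ^ 3 ≤ 3 ^ 3 := by gcongr
        _ = 27 := by norm_num
    rcases le_total x (3 / 2) with h | h
    · rw [max_eq_left (by linarith), max_eq_left (by linarith)]
      nlinarith [pow_nonneg (sub_nonneg.2 hx1) 3]
    · rw [max_eq_right (show 0 ≤ x - 3 / 2 by linarith)]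
      rcases le_total x (5 / 2) with h' | h'
      · rw [max_eq_left (by linarith)]
        have : (-(1 / 2)) ^ 3 ≤ (x - 2) ^ 3 :=
          (Odd.strictMono_pow (by decide)).monotone (by linarith)
        nlinarith
      · rw [max_eq_right (by linarith)]
        have : (-(1 / 2)) ^ 3 ≤ (x - 3) ^ 3 :=
          (Odd.strictMono_pow (by decide)).monotone (by linarith)
        nlinarith
  · intro n hn
    have hn' : n ≤ -3 ∨ 4 ≤ n := by
      simp only [Finset.mem_Icc] at hn
      omega
    have h : 3 ≤ |(n : ℝ) - 1 / 2| := by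
      rcases hn' with h | h
      · have : (n : ℝ) ≤ -3 := by exact_mod_cast h
        exact le_abs.2 (Or.inr (by linarith))
      · have : (4 : ℝ) ≤ n := by exact_mod_cast h
        exact le_abs.2 (Or.inl (by linarith))
    rw [hterm, hmax, max_eq_left (by linarith)]
    norm_num

section Product

variable {e : ℕ} {x : Fin e → ℝ}

lemma prod_two_thirds_mul (x : Fin e → ℝ) : ∏ j, (2 / 3 * x j) = (2 / 3 : ℝ) ^ e * ∏ j, x j := by
  rw [Finset.prod_mul_distrib, Finset.prod_const, Finset.card_univ, Fintype.card_fin]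

lemma one_le_prod_Omega_zero (hx : ∀ j, 0 < x j) : 1 ≤ ∏ j, Omega (1 / x j) 0 := by
  simpa using Finset.prod_le_prod (s := Finset.univ) (fun _ _ => zero_le_one)
    fun j _ => one_le_Omega_zero (hx j)

lemma prod_le_prod_Omega_zero (hx : ∀ j, 0 < x j) :
    (2 / 3 : ℝ) ^ e * ∏ j, x j ≤ ∏ j, Omega (1 / x j) 0 := by
  rw [← prod_two_thirds_mul]
  exact Finset.prod_le_prod (fun j _ => by have := hx j; positivity)
    fun j _ => two_thirds_mul_le_Omega_zero (hx j)

lemma Omega_zero_le_prod (hx : ∀ j, 0 < x j) (i : Fin e) :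
    Omega (1 / x i) 0 ≤ ∏ j, Omega (1 / x j) 0 := by
  rw [← Finset.mul_prod_erase _ _ (Finset.mem_univ i)]
  refine le_mul_of_one_le_right (Omega_nonneg _ _) ?_
  simpa using Finset.prod_le_prod (s := Finset.univ.erase i) (fun _ _ => zero_le_one)
    fun j _ => one_le_Omega_zero (hx j)

/-- If some `x i ≤ 1`, the trapezoidal overestimate of the product is at least `1 / 3`. -/
lemma third_le_prod_sub_prod (hx : ∀ j, 0 < x j) {i : Fin e} (hi : x i ≤ 1) :
    1 / 3 ≤ ∏ j, Omega (1 / x j) 0 - (2 / 3 : ℝ) ^ e * ∏ j, x j := by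
  have h : (2 / 3 : ℝ) ^ e * ∏ j, x j ≤ 2 / 3 * ∏ j, Omega (1 / x j) 0 := by
    rw [← prod_two_thirds_mul, ← Finset.mul_prod_erase _ _ (Finset.mem_univ i),
      ← Finset.mul_prod_erase _ (fun j => Omega (1 / x j) 0) (Finset.mem_univ i), ← mul_assoc]
    refine mul_le_mul (by linarith [one_le_Omega_zero (hx i)]) ?_ ?_ ?_
    · exact Finset.prod_le_prod (fun j _ => by have := hx j; positivity)
        fun j _ => two_thirds_mul_le_Omega_zero (hx j)
    · exact Finset.prod_nonneg fun j _ => by have := hx j; positivity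
    · exact mul_nonneg (by norm_num) (Omega_nonneg _ _)
  linarith [one_le_prod_Omega_zero hx]

lemma prod_Omega_midpoint_le (he : 1 ≤ e) (h1 : ∀ j, 1 ≤ x j) (h3 : ∀ j, x j ≤ 3) :
    ∏ j, Omega (1 / x j) (1 + 2 * (1 / 4 - x j / 2) / x j) ≤
      (2 / 3 : ℝ) ^ e * ∏ j, x j - 1 / 108 * (2 / 3) ^ e := by
  have hle : ∏ j, Omega (1 / x j) (1 + 2 * (1 / 4 - x j / 2) / x j) ≤
      ∏ j, (107 / 108 * (2 / 3 * x j)) :=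
    Finset.prod_le_prod (fun j _ => Omega_nonneg _ _) fun j _ => Omega_midpoint_le (h1 j) (h3 j)
  have hprod : 1 ≤ ∏ j, x j := by
    simpa using Finset.prod_le_prod (s := Finset.univ) (fun _ _ => zero_le_one)
      fun j _ => h1 j
  rw [Finset.prod_mul_distrib, prod_two_thirds_mul, Finset.prod_const, Finset.card_univ,
    Fintype.card_fin] at hle
  have hpow : (107 / 108 : ℝ) ^ e ≤ 107 / 108 :=
    pow_le_of_le_one (by norm_num) (by norm_num) (by omega)
  have h0 : (0 : ℝ) < (2 / 3) ^ e := by positivity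
  nlinarith [mul_le_mul_of_nonneg_right hpow
    (mul_nonneg h0.le (zero_le_one.trans hprod)), mul_le_mul_of_nonneg_left hprod h0.le]

end Product

lemma two_pow_succ_div_three_pow (e : ℕ) :
    (2 : ℝ) ^ (e + 1) / 3 ^ e = 2 * (2 / 3 : ℝ) ^ e := by
  rw [div_pow, pow_succ]
  ring

lemma one_le_Aquart_value {e : ℕ} {x : Fin e → ℝ} (hx : ∀ j, 0 < x j) :
    1 ≤ -(2 / 3 : ℝ) ^ e * ∏ j, x j + 2 * ∏ j, Omega (1 / x j) 0 := by
  linarith [one_le_prod_Omega_zero hx, prod_le_prod_Omega_zero hx]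

lemma min_le_Bquart_value {e : ℕ} {x : Fin e → ℝ} (hx : ∀ j, 0 < x j) (y : Fin e → ℝ) :
    min (1 / 3) ((1 / 4) ^ e) ≤
      -((2 : ℝ) ^ (e + 1) / 3 ^ e) * ∏ j, x j + 2 * ∏ j, Omega (1 / x j) 0 +
        ∏ j, Omega (1 / x j) (1 + 2 * y j / x j) := by
  rw [two_pow_succ_div_three_pow]
  by_cases h : ∃ i, x i ≤ 1
  · obtain ⟨i, hi⟩ := h
    refine (min_le_left _ _).trans ?_
    have h0 : 0 ≤ ∏ j, Omega (1 / x j) (1 + 2 * y j / x j) :=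
      Finset.prod_nonneg fun j _ => Omega_nonneg _ _
    linarith [third_le_prod_sub_prod hx hi]
  · push Not at h
    refine (min_le_right _ _).trans ?_
    have h0 : (1 / 4 : ℝ) ^ e ≤ ∏ j, Omega (1 / x j) (1 + 2 * y j / x j) := by
      simpa using Finset.prod_le_prod (s := Finset.univ)
        (fun _ _ => by norm_num : ∀ j ∈ Finset.univ, (0 : ℝ) ≤ 1 / 4)
        fun j _ => quarter_le_Omega (h j).le (1 + 2 * y j / x j)
    linarith [prod_le_prod_Omega_zero hx]

lemma Aquart_pos (e : ℕ) : 0 < Aquart e := by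
  refine zero_lt_one.trans_le (le_csInf ⟨_, fun _ => 1, fun _ => one_pos, rfl⟩ ?_)
  rintro _ ⟨x, hx, rfl⟩
  exact one_le_Aquart_value hx

lemma Bquart_pos (e : ℕ) : 0 < Bquart e := by
  refine (show (0 : ℝ) < min (1 / 3) ((1 / 4) ^ e) by positivity).trans_le
    (le_csInf ⟨_, fun _ => 1, fun _ => 0, fun _ => one_pos, rfl⟩ ?_)
  rintro _ ⟨x, y, hx, rfl⟩
  exact min_le_Bquart_value hx y

lemma Bquart_le_of_value_lt_two {e : ℕ} (he : 1 ≤ e) {x : Fin e → ℝ} (hx : ∀ j, 0 < x j)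
    (h2 : -(2 / 3 : ℝ) ^ e * ∏ j, x j + 2 * ∏ j, Omega (1 / x j) 0 < 2) :
    Bquart e ≤ -(2 / 3 : ℝ) ^ e * ∏ j, x j + 2 * ∏ j, Omega (1 / x j) 0 -
      1 / 108 * (2 / 3) ^ e := by
  have hx3 (j : Fin e) : x j ≤ 3 := by
    linarith [two_thirds_mul_le_Omega_zero (hx j), Omega_zero_le_prod hx j,
      prod_le_prod_Omega_zero hx]
  let z : Fin e → ℝ := fun j => max 1 (x j)
  have hz1 (j : Fin e) : 1 ≤ z j := le_max_left _ _
  have hz3 (j : Fin e) : z j ≤ 3 := max_le (by norm_num) (hx3 j)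
  have hΩ : ∏ j, Omega (1 / z j) 0 = ∏ j, Omega (1 / x j) 0 := by
    refine Finset.prod_congr rfl fun j _ => ?_
    rcases le_total (x j) 1 with h | h
    · rw [show z j = 1 from max_eq_left h, Omega_zero_eq_one (hx j) h,
        Omega_zero_eq_one one_pos le_rfl]
    · rw [show z j = x j from max_eq_right h]
  have hprod : ∏ j, x j ≤ ∏ j, z j :=
    Finset.prod_le_prod (fun j _ => (hx j).le) fun j _ => le_max_right _ _
  have hB : Bquart e ≤ -((2 : ℝ) ^ (e + 1) / 3 ^ e) * ∏ j, z j + 2 * ∏ j, Omega (1 / z j) 0 +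
      ∏ j, Omega (1 / z j) (1 + 2 * (1 / 4 - z j / 2) / z j) := by
    refine csInf_le ⟨min (1 / 3) ((1 / 4) ^ e), ?_⟩
      ⟨z, fun j => 1 / 4 - z j / 2, fun j => one_pos.trans_le (hz1 j), rfl⟩
    rintro _ ⟨x, y, hx, rfl⟩
    exact min_le_Bquart_value hx y
  rw [two_pow_succ_div_three_pow, hΩ] at hB
  have h0 : (0 : ℝ) < (2 / 3) ^ e := by positivity
  linarith [prod_Omega_midpoint_le he hz1 hz3, mul_le_mul_of_nonneg_left hprod h0.le]

lemma Bquart_lt_Aquart {e : ℕ} (he : 1 ≤ e) : Bquart e < Aquart e := by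
  have h0 : (0 : ℝ) < (2 / 3) ^ e := by positivity
  have hA : Aquart e ≤ 2 - (2 / 3) ^ e := by
    refine csInf_le ⟨1, ?_⟩ ⟨fun _ => 1, fun _ => one_pos, ?_⟩
    · rintro _ ⟨x, hx, rfl⟩
      exact one_le_Aquart_value hx
    · simp only [Omega_zero_eq_one one_pos le_rfl, Finset.prod_const_one]
      ring
  obtain ⟨_, ⟨x, hx, rfl⟩, hlt⟩ := exists_lt_of_csInf_lt
    (s := {r : ℝ | ∃ x : Fin e → ℝ, (∀ j, 0 < x j) ∧
      r = -(2 / 3 : ℝ) ^ e * ∏ j, x j + 2 * ∏ j, Omega (1 / x j) 0})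
    ⟨_, fun _ => 1, fun _ => one_pos, rfl⟩
    (show Aquart e < Aquart e + 1 / 108 * (2 / 3) ^ e by linarith)
  linarith [Bquart_le_of_value_lt_two he hx (by linarith)]

/-- for every `e ≥ 1`, both infima are positive and `B_e < A_e`, where
`A_e` and `B_e` are the positive fourth roots of `Aquart e` and `Bquart e`. -/
theorem stmt_7 (e : ℕ) (he : 1 ≤ e) :
    0 < Aquart e ∧ 0 < Bquart e ∧
      Bquart e ^ ((1 : ℝ) / 4) < Aquart e ^ ((1 : ℝ) / 4) :=
  ⟨Aquart_pos e, Bquart_pos e,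
    Real.rpow_lt_rpow (Bquart_pos e).le (Bquart_lt_Aquart he) (by norm_num)⟩
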